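/- Let a > 0, λ > 0, μ > 0, and let X ∈ ℝ^{m×n} (m ≤ n) have singular value decomposition X = U·Diag(σ₁(X), …, σ_m(X))·Vᵀ. Then the matrix Y* = U·Diag(g_{λμ}(σ₁(X)), …, g_{λμ}(σ_m(X)))·Vᵀ, with singular values σ_i(Y*) = g_{λμ}(σ_i(X)) when σ_i(X) > t* and σ_i(Y*) = 0 when σ_i(X) ≤ t*, is a global minimizer of Y ↦ ‖Y − X‖_F² + λμ·P(Y) over Y ∈ ℝ^{m×n}, where t* = (λμ/2)a if λ ≤ 1/(a²μ) and t* = √(λμ) − 1/(2a) if λ > 1/(a²μ). -/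

import Mathlib

noncomputable section

open Matrix

/-- The fraction function `ρ_a(t) = a|t|/(a|t|+1)`. -/
def fracFn (a t : ℝ) : ℝ := a * |t| / (a * |t| + 1)

/-- The singular values of a real matrix (square roots of the eigenvalues of `X * Xᵀ`),
arranged in descending order. -/
def sval {m n : ℕ} (X : Matrix (Fin m) (Fin n) ℝ) (i : Fin m) : ℝ :=
  ((List.ofFn fun j : Fin m =>
      Real.sqrt ((Matrix.isHermitian_mul_conjTranspose_self X).eigenvalues j)).mergeSort
      (fun x y => decide (y ≤ x)))[(i : ℕ)]'(by simp)

/-- `P(X) = Σ_{i=1}^m ρ_a(σ_i(X))`. -/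
def Pmat (a : ℝ) {m n : ℕ} (X : Matrix (Fin m) (Fin n) ℝ) : ℝ := ∑ i, fracFn a (sval X i)

/-- The squared Frobenius norm. -/
def frobSq {m n : ℕ} (X : Matrix (Fin m) (Fin n) ℝ) : ℝ := ∑ i, ∑ j, (X i j) ^ 2

/-- `φ(γ) = arccos(27λa²/(4(1+a|γ|)³) − 1)`. -/
def phiFn (a lam γ : ℝ) : ℝ := Real.arccos (27 * lam * a ^ 2 / (4 * (1 + a * |γ|) ^ 3) - 1)

/-- The threshold function `g_λ`. -/
def gFn (a lam γ : ℝ) : ℝ :=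
  Real.sign γ *
    (((1 + a * |γ|) / 3 * (1 + 2 * Real.cos (phiFn a lam γ / 3 - Real.pi / 3)) - 1) / a)

/-- The rectangular diagonal `m × n` matrix `Diag(s₁, …, s_m)`. -/
def rdiag {m n : ℕ} (s : Fin m → ℝ) : Matrix (Fin m) (Fin n) ℝ :=
  Matrix.of fun i j => if (i : ℕ) = (j : ℕ) then s i else 0

lemma scalar_le_of_cubic {k c z₀ z : ℝ} (hz₀ : 0 < z₀) (hroot : z₀ ^ 3 - c * z₀ ^ 2 + k / 2 = 0)
    (hc : c - 1 / 2 ≤ z₀) (hz : 1 ≤ z) :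
    (z₀ - c) ^ 2 + k * (1 - 1 / z₀) ≤ (z - c) ^ 2 + k * (1 - 1 / z) := by
  have hzpos : 0 < z := by linarith
  have hk : k = 2 * z₀ ^ 2 * (c - z₀) := by linarith
  have h : (z - c) ^ 2 + k * (1 - 1 / z) - ((z₀ - c) ^ 2 + k * (1 - 1 / z₀))
      = (z - z₀) ^ 2 / z * (z + 2 * z₀ - 2 * c) := by
    rw [hk]; field_simp; ring
  have : 0 ≤ (z - z₀) ^ 2 / z * (z + 2 * z₀ - 2 * c) :=
    mul_nonneg (by positivity) (by linarith)
  linarith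

/-- Trigonometric solution of the cubic `z³ - c z² + k / 2 = 0`. -/
lemma trig_root_spec {k c : ℝ} (hc : 0 < c) (hk : 0 ≤ k) (hkc : 27 * k ≤ 8 * c ^ 3) :
    let z := c / 3 * (1 + 2 * Real.cos
      (Real.arccos (27 * k / (4 * c ^ 3) - 1) / 3 - Real.pi / 3))
    z ^ 3 - c * z ^ 2 + k / 2 = 0 ∧ 2 * c / 3 ≤ z := by
  intro z
  set φ := Real.arccos (27 * k / (4 * c ^ 3) - 1) with hφ
  set u := Real.cos (φ / 3 - Real.pi / 3) with hu
  have hc3 : 0 < c ^ 3 := by positivity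
  have hcos : Real.cos φ = 27 * k / (4 * c ^ 3) - 1 := by
    refine Real.cos_arccos ?_ ?_
    · have : 0 ≤ 27 * k / (4 * c ^ 3) := by positivity
      linarith
    · have : 27 * k / (4 * c ^ 3) ≤ 2 := by
        rw [div_le_iff₀ (by positivity)]; linarith
      linarith
  have htriple : 4 * u ^ 3 - 3 * u = -Real.cos φ := by
    rw [hu, ← Real.cos_three_mul, ← Real.cos_sub_pi]
    congr 1; ring
  constructor
  · have h1 : z ^ 3 - c * z ^ 2 = c ^ 3 / 27 * (2 * (4 * u ^ 3 - 3 * u) - 2) := by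
      simp only [z]; ring
    rw [h1, htriple, hcos]
    field_simp
    ring
  · have hφ0 : 0 ≤ φ := Real.arccos_nonneg _
    have hφπ : φ ≤ Real.pi := Real.arccos_le_pi _
    have hhalf : 1 / 2 ≤ u := by
      rw [hu, ← Real.cos_pi_div_three, ← Real.cos_neg (φ / 3 - Real.pi / 3)]
      apply Real.cos_le_cos_of_nonneg_of_le_pi <;> linarith
    have : 0 ≤ c * (u - 1 / 2) := mul_nonneg hc.le (by linarith)
    simp only [z]
    linarith

lemma lt_of_cubic_neg {k c z w : ℝ} (hc : 0 < c) (hz : z ^ 3 - c * z ^ 2 + k / 2 = 0)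
    (hcz : 2 * c / 3 ≤ z) (hw : w ^ 3 - c * w ^ 2 + k / 2 < 0) : w < z := by
  by_contra! h
  have h1 : 0 ≤ (w - z) * (w ^ 2 + w * z + z ^ 2 - c * (w + z)) := by
    apply mul_nonneg (by linarith)
    nlinarith [mul_nonneg (sub_nonneg.2 hcz) (sub_nonneg.2 (hcz.trans h)),
      mul_nonneg (sub_nonneg.2 h) hc.le, mul_nonneg (sub_nonneg.2 hcz) hc.le,
      sq_nonneg (w - z), mul_nonneg (sub_nonneg.2 h) (sub_nonneg.2 hcz)]
  nlinarith

/-- The threshold operator solves the scalar fraction-penalized least squares problem. -/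
lemma threshold_minimizes {a L x y t : ℝ} (ha : 0 < a) (hL : 0 < L) (hx : 0 ≤ x) (hy : 0 ≤ y)
    (ht : t = if L * a ^ 2 ≤ 1 then L / 2 * a else Real.sqrt L - 1 / (2 * a)) :
    ((if x > t then gFn a L x else 0) - x) ^ 2 + L * fracFn a (if x > t then gFn a L x else 0)
      ≤ (y - x) ^ 2 + L * fracFn a y := by
  obtain ⟨s, hs, hsL⟩ : ∃ s : ℝ, 0 < s ∧ L = s ^ 2 :=
    ⟨Real.sqrt L, Real.sqrt_pos.2 hL, (Real.sq_sqrt hL.le).symm⟩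
  rw [hsL, Real.sqrt_sq hs.le] at ht
  subst hsL
  have hsa : 0 < s * a := by positivity
  have hray : 0 < a * y + 1 := by positivity
  split_ifs with hxt
  · set c := 1 + a * x with hc
    set k := s ^ 2 * a ^ 2 with hk
    have hcpos : 0 < c := by positivity
    have hkpos : 0 < k := by positivity
    have hksq : k = (s * a) ^ 2 := by rw [hk]; ring
    have hx0 : 0 < x ∧ 27 * k ≤ 8 * c ^ 3 ∧ k < (c - 1 / 2) ^ 2 ∧ 0 < c - 1 / 2 ∧
        (k ≤ 1 → 1 - c + k / 2 < 0) ∧ (1 < k → 1 < c - 1 / 2) := by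
      by_cases hk1 : k ≤ 1
      · rw [if_pos hk1] at ht
        have hxpos : 0 < x := lt_of_le_of_lt (by rw [ht]; positivity) hxt
        have h1 : k / 2 < a * x := by
          have := mul_lt_mul_of_pos_left hxt ha
          rw [ht] at this
          rw [hk]; linarith
        have hck : 1 + k / 2 ≤ c := by linarith
        have hcube : (1 + k / 2) ^ 3 ≤ c ^ 3 := pow_le_pow_left₀ (by positivity) hck 3
        refine ⟨hxpos, ?_, ?_, by linarith, fun _ => by linarith, fun h => by linarith⟩
        · nlinarith [mul_nonneg (sq_nonneg (k - 1)) (by linarith : (0 : ℝ) ≤ k + 8)]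
        · nlinarith [sq_nonneg (k - 1), mul_pos (by linarith : (0 : ℝ) < c - 1 - k / 2)
            (by linarith : (0 : ℝ) < c + k / 2)]
      · rw [if_neg hk1] at ht
        have hsa1 : 1 < s * a := by
          by_contra! h
          exact hk1 (by rw [hksq]; nlinarith)
        have h1 : s * a - 1 / 2 < a * x := by
          have := mul_lt_mul_of_pos_left hxt ha
          have h2 : a * t = s * a - 1 / 2 := by rw [ht]; field_simp
          linarith
        have hxpos : 0 < x := by
          by_contra! h
          nlinarith
        have hck : 1 / 2 + s * a ≤ c := by linarith
        have hcube : (1 / 2 + s * a) ^ 3 ≤ c ^ 3 := pow_le_pow_left₀ (by positivity) hck 3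
        refine ⟨hxpos, ?_, ?_, by linarith, fun h => absurd h hk1, fun _ => by linarith⟩
        · rw [hksq]
          nlinarith [mul_nonneg (sq_nonneg (s * a - 1)) (by linarith : (0 : ℝ) ≤ 8 * (s * a) + 1)]
        · rw [hksq]
          nlinarith
    obtain ⟨hxpos, hkc, hkc2, hc2, hsmall, hlarge⟩ := hx0
    obtain ⟨hroot, hge⟩ := trig_root_spec hcpos hkpos.le hkc
    set z := c / 3 * (1 + 2 * Real.cos
      (Real.arccos (27 * k / (4 * c ^ 3) - 1) / 3 - Real.pi / 3)) with hz
    have hzc : c - 1 / 2 < z := by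
      refine lt_of_cubic_neg hcpos hroot hge ?_
      nlinarith
    have hz1 : 1 < z := by
      rcases le_or_gt k 1 with h | h
      · refine lt_of_cubic_neg hcpos hroot hge ?_
        linarith [hsmall h]
      · linarith [hlarge h]
    have hg : gFn a (s ^ 2) x = (z - 1) / a := by
      rw [gFn, phiFn, Real.sign_of_pos hxpos, abs_of_pos hxpos, one_mul, hz, hc, hk, mul_assoc 27]
    have hzpos : 0 < z := by linarith
    have hg0 : 0 ≤ (z - 1) / a := div_nonneg (by linarith) ha.le
    have key := scalar_le_of_cubic hzpos hroot hzc.le (z := a * y + 1) (by nlinarith)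
    rw [hg, fracFn, fracFn, abs_of_nonneg hg0, abs_of_nonneg hy, mul_div_cancel₀ _ ha.ne']
    have e1 : ((z - 1) / a - x) ^ 2 + s ^ 2 * ((z - 1) / (z - 1 + 1))
        = ((z - c) ^ 2 + k * (1 - 1 / z)) / a ^ 2 := by
      rw [hc, hk, sub_add_cancel]; field_simp; ring
    have e2 : (y - x) ^ 2 + s ^ 2 * (a * y / (a * y + 1))
        = ((a * y + 1 - c) ^ 2 + k * (1 - 1 / (a * y + 1))) / a ^ 2 := by
      rw [hc, hk]; field_simp; ring
    rw [e1, e2]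
    gcongr
  · simp only [fracFn, abs_zero, mul_zero, zero_div, add_zero, abs_of_nonneg hy]
    have h1 : 2 * (a * x) * (a * y + 1) ≤ a * y * (a * y + 1) + (s * a) ^ 2 := by
      have hxt' : a * x ≤ a * t := mul_le_mul_of_nonneg_left (not_lt.1 hxt) ha.le
      have hay : 0 ≤ a * y := by positivity
      have h2 := mul_le_mul_of_nonneg_right hxt' hray.le
      by_cases hk1 : s ^ 2 * a ^ 2 ≤ 1
      · rw [if_pos hk1] at ht
        have h3 : a * t = (s * a) ^ 2 / 2 := by rw [ht]; ring
        rw [h3] at h2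
        nlinarith
      · rw [if_neg hk1] at ht
        have h3 : a * t = s * a - 1 / 2 := by rw [ht]; field_simp
        rw [h3] at h2
        nlinarith [sq_nonneg (a * y + 1 - s * a)]
    have h4 : (y - x) ^ 2 + s ^ 2 * (a * y / (a * y + 1)) - (0 - x) ^ 2
        = y / (a * (a * y + 1)) *
          (a * y * (a * y + 1) + (s * a) ^ 2 - 2 * (a * x) * (a * y + 1)) := by
      field_simp; ring
    have h5 : 0 ≤ y / (a * (a * y + 1)) *
          (a * y * (a * y + 1) + (s * a) ^ 2 - 2 * (a * x) * (a * y + 1)) :=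
      mul_nonneg (by positivity) (by linarith)
    linarith

/-- Functions of the singular values may be summed over the unsorted eigenvalues. -/
lemma sum_sval {m n : ℕ} (X : Matrix (Fin m) (Fin n) ℝ) (f : ℝ → ℝ) :
    ∑ i, f (sval X i) =
      ∑ j, f (Real.sqrt ((Matrix.isHermitian_mul_conjTranspose_self X).eigenvalues j)) := by
  have sum_getElem : ∀ (l : List ℝ) (k : ℕ) (h : l.length = k),
      ∑ i : Fin k, f (l[(i : ℕ)]'(by omega)) = (l.map f).sum := by
    rintro l k rfl
    exact Fin.sum_univ_fun_getElem l f
  simp only [sval]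
  rw [sum_getElem _ m (by simp), ((List.mergeSort_perm _ _).map f).sum_eq, List.map_ofFn, List.sum_ofFn]
  rfl

lemma sval_nonneg {m n : ℕ} (X : Matrix (Fin m) (Fin n) ℝ) (i : Fin m) : 0 ≤ sval X i := by
  have h := List.getElem_mem (l := (List.ofFn fun j : Fin m =>
      Real.sqrt ((Matrix.isHermitian_mul_conjTranspose_self X).eigenvalues j)).mergeSort
      (fun x y => decide (y ≤ x))) (n := (i : ℕ)) (by simp)
  rw [List.mem_mergeSort, List.mem_ofFn] at h
  obtain ⟨j, hj⟩ := h
  rw [sval, ← hj]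
  exact Real.sqrt_nonneg _

/-- Any function of the singular values can be summed over a diagonalization of `X * Xᵀ`. -/
lemma sum_sval_of_mul_transpose_eq {m n : ℕ} (X : Matrix (Fin m) (Fin n) ℝ)
    (U : Matrix (Fin m) (Fin m) ℝ) (hU : Uᵀ * U = 1) (d : Fin m → ℝ)
    (hX : X * Xᵀ = U * diagonal d * Uᵀ) (f : ℝ → ℝ) :
    ∑ i, f (sval X i) = ∑ i, f (Real.sqrt (d i)) := by
  have hchar : (X * Xᴴ).charpoly = (diagonal d).charpoly := by
    rw [conjTranspose_eq_transpose_of_trivial, hX, Matrix.mul_assoc, charpoly_mul_comm, Matrix.mul_assoc, hU,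
      Matrix.mul_one]
  have hroots := (Matrix.isHermitian_mul_conjTranspose_self X).roots_charpoly_eq_eigenvalues
  have hprod : ∏ i, (Polynomial.X - Polynomial.C (d i)) =
      ((Finset.univ.val.map d).map fun r => Polynomial.X - Polynomial.C r).prod := by
    rw [Multiset.map_map]; rfl
  rw [hchar, charpoly_diagonal, hprod, Polynomial.roots_multiset_prod_X_sub_C] at hroots
  rw [sum_sval]
  have := congrArg (fun s : Multiset ℝ => (s.map fun x => f (Real.sqrt x)).sum) hroots
  simpa [Function.comp_def, List.sum_ofFn] using this.symm

lemma frobSq_eq_trace {m n : ℕ} (X : Matrix (Fin m) (Fin n) ℝ) :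
    frobSq X = (X * Xᵀ).trace := by
  simp [frobSq, trace, mul_apply, sq]

lemma rdiag_eq {m n : ℕ} (s : Fin m → ℝ) :
    (rdiag s : Matrix (Fin m) (Fin n) ℝ) =
      diagonal s * (rdiag fun _ => 1 : Matrix (Fin m) (Fin n) ℝ) := by
  ext i j
  simp [rdiag, diagonal_mul]

lemma rdiag_one_mul_transpose {m n : ℕ} (hmn : m ≤ n) :
    (rdiag fun _ => 1 : Matrix (Fin m) (Fin n) ℝ) * (rdiag fun _ => 1 : Matrix (Fin m) (Fin n) ℝ)ᵀ = 1 := by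
  ext i j
  rw [mul_apply, Finset.sum_eq_single (Fin.castLE hmn i)]
  · simp [rdiag, one_apply, Fin.ext_iff, eq_comm]
  · intro b _ hb
    have : (i : ℕ) ≠ b := fun h => hb (Fin.ext h.symm)
    simp [rdiag, this]
  · simp

/-- A thin singular value decomposition, where rows of `G` for zero singular values vanish. -/
lemma exists_thin_svd {m n : ℕ} (Y : Matrix (Fin m) (Fin n) ℝ) :
    ∃ (Q : Matrix (Fin m) (Fin m) ℝ) (t e : Fin m → ℝ) (G : Matrix (Fin m) (Fin n) ℝ),
      Q * Qᵀ = 1 ∧ Qᵀ * Q = 1 ∧ (∀ j, 0 ≤ t j) ∧ (∀ j, 0 ≤ e j ∧ e j ≤ 1) ∧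
      G * Gᵀ = diagonal e ∧ Y = Q * diagonal t * G ∧ frobSq Y = ∑ j, t j ^ 2 ∧
      ∀ f : ℝ → ℝ, ∑ i, f (sval Y i) = ∑ j, f (t j) := by
  have hH := Matrix.isHermitian_mul_conjTranspose_self Y
  set d := hH.eigenvalues
  have hd0 : ∀ j, 0 ≤ d j := (Matrix.posSemidef_self_mul_conjTranspose Y).eigenvalues_nonneg
  obtain ⟨Q, hQ1, hspec⟩ : ∃ Q : Matrix (Fin m) (Fin m) ℝ,
      Q * Qᵀ = 1 ∧ Y * Yᵀ = Q * diagonal d * Qᵀ := by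
    refine ⟨hH.eigenvectorUnitary, ?_, ?_⟩
    · simpa [star_eq_conjTranspose] using Unitary.coe_mul_star_self hH.eigenvectorUnitary
    · have := hH.spectral_theorem
      rw [Unitary.conjStarAlgAut_apply] at this
      simpa [star_eq_conjTranspose, Function.comp_def] using this
  have hQ2 : Qᵀ * Q = 1 := mul_eq_one_comm.1 hQ1
  have hZ : (Qᵀ * Y) * (Qᵀ * Y)ᵀ = diagonal d := by
    calc (Qᵀ * Y) * (Qᵀ * Y)ᵀ = Qᵀ * (Y * Yᵀ) * Q := by
          simp only [transpose_mul, transpose_transpose, Matrix.mul_assoc]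
      _ = (Qᵀ * Q) * diagonal d * (Qᵀ * Q) := by rw [hspec]; simp only [Matrix.mul_assoc]
      _ = diagonal d := by rw [hQ2, Matrix.one_mul, Matrix.mul_one]
  set Z := Qᵀ * Y with hZdef
  set t : Fin m → ℝ := fun j => Real.sqrt (d j) with ht
  have ht2 : ∀ j, t j ^ 2 = d j := fun j => Real.sq_sqrt (hd0 j)
  refine ⟨Q, t, fun j => (t j)⁻¹ * d j * (t j)⁻¹, diagonal (fun j => (t j)⁻¹) * Z, hQ1, hQ2,
    fun j => Real.sqrt_nonneg _, fun j => ?_, ?_, ?_, ?_, fun f => sum_sval Y f⟩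
  · dsimp only
    rw [← ht2 j]
    by_cases h : t j = 0
    · simp [h]
    · have : (t j)⁻¹ * t j ^ 2 * (t j)⁻¹ = 1 := by field_simp
      simp [this]
  · rw [transpose_mul, diagonal_transpose, Matrix.mul_assoc, ← Matrix.mul_assoc Z, hZ, diagonal_mul_diagonal,
      diagonal_mul_diagonal]
    simp only [_root_.mul_assoc]
  · have hTZ : diagonal t * (diagonal (fun j => (t j)⁻¹) * Z) = Z := by
      ext i l
      rw [diagonal_mul, diagonal_mul, ← _root_.mul_assoc]
      by_cases h : t i = 0
      · have hdi : ∑ l, Z i l * Z i l = 0 := by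
          have := congrFun (congrFun hZ i) i
          rw [mul_apply, diagonal_apply_eq, ← ht2 i, h] at this
          simpa using this
        have := (Finset.sum_eq_zero_iff_of_nonneg fun l _ => mul_self_nonneg (Z i l)).1 hdi l
          (Finset.mem_univ l)
        rw [mul_self_eq_zero.1 this, mul_zero]
      · rw [mul_inv_cancel₀ h, one_mul]
    rw [Matrix.mul_assoc, hTZ, hZdef, ← Matrix.mul_assoc, hQ1, Matrix.one_mul]
  · rw [frobSq_eq_trace, hspec, trace_mul_comm, ← Matrix.mul_assoc, hQ2, Matrix.one_mul, trace_diagonal]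
    simp only [ht2]

/-- Bessel's inequality for the rows of `G`. -/
lemma sum_sq_mul_transpose_le {l m n : ℕ} (K : Matrix (Fin l) (Fin n) ℝ)
    (G : Matrix (Fin m) (Fin n) ℝ) (e : Fin m → ℝ) (he : ∀ j, e j ≤ 1)
    (hG : G * Gᵀ = diagonal e) (i : Fin l) :
    ∑ j, (K * Gᵀ) i j ^ 2 ≤ (K * Kᵀ) i i := by
  set B := K * Gᵀ with hB
  have h0 : 0 ≤ ((K - B * G) * (K - B * G)ᵀ) i i := by
    rw [mul_apply]
    exact Finset.sum_nonneg fun j _ => mul_self_nonneg _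
  have hexp : (K - B * G) * (K - B * G)ᵀ = K * Kᵀ - B * Bᵀ - B * Bᵀ + B * diagonal e * Bᵀ := by
    have hBt : G * Kᵀ = Bᵀ := by rw [hB, transpose_mul, transpose_transpose]
    rw [transpose_sub, transpose_mul, Matrix.sub_mul, Matrix.mul_sub, Matrix.mul_sub,
      ← Matrix.mul_assoc K, ← hB, Matrix.mul_assoc B G, hBt, Matrix.mul_assoc B G, ← Matrix.mul_assoc G, hG, ← Matrix.mul_assoc B]
    abel
  have h1 : (B * Bᵀ) i i = ∑ j, B i j ^ 2 := by simp [mul_apply, sq]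
  have h2 : (B * diagonal e * Bᵀ) i i ≤ ∑ j, B i j ^ 2 := by
    rw [mul_apply]
    refine Finset.sum_le_sum fun j _ => ?_
    rw [mul_diagonal, transpose_apply]
    nlinarith [mul_nonneg (sub_nonneg.2 (he j)) (sq_nonneg (B i j))]
  rw [hexp, Matrix.add_apply, Matrix.sub_apply, Matrix.sub_apply, h1] at h0
  linarith

lemma sum_sq_row_of_mul_transpose {m : ℕ} {A : Matrix (Fin m) (Fin m) ℝ} (hA : A * Aᵀ = 1)
    (i : Fin m) : ∑ j, A i j ^ 2 = 1 := by
  have := congrFun (congrFun hA i) i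
  rw [mul_apply, one_apply_eq] at this
  simpa [sq] using this

/-- Pairwise bounds average to a bound over a doubly substochastic weight matrix. -/
lemma sum_le_of_substochastic {m : ℕ} {s t v p : Fin m → ℝ} {C W : Fin m → Fin m → ℝ}
    (hs : ∀ i, 0 ≤ s i) (ht : ∀ j, 0 ≤ t j) (hp : ∀ j, 0 ≤ p j)
    (hv : ∀ i j, v i ≤ (t j - s i) ^ 2 + p j) (hv0 : ∀ i, v i ≤ s i ^ 2)
    (hW : ∀ i j, 0 ≤ W i j) (hrow : ∀ i, ∑ j, W i j ≤ 1) (hcol : ∀ j, ∑ i, W i j ≤ 1)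
    (hC : ∀ i j, C i j ≤ W i j) :
    ∑ i, v i ≤ ∑ j, t j ^ 2 + ∑ i, s i ^ 2 - 2 * ∑ i, ∑ j, s i * t j * C i j + ∑ j, p j := by
  have h1 : 0 ≤ ∑ i, (1 - ∑ j, W i j) * (s i ^ 2 - v i) :=
    Finset.sum_nonneg fun i _ =>
      mul_nonneg (sub_nonneg.2 (hrow i)) (sub_nonneg.2 (hv0 i))
  have h2 : 0 ≤ ∑ j, (1 - ∑ i, W i j) * (t j ^ 2 + p j) :=
    Finset.sum_nonneg fun j _ =>
      mul_nonneg (sub_nonneg.2 (hcol j)) (add_nonneg (sq_nonneg _) (hp j))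
  have h3 : ∑ i, ∑ j, 2 * (s i * t j * C i j) ≤
      ∑ i, ∑ j, (W i j * (s i ^ 2 - v i) + W i j * (t j ^ 2 + p j)) := by
    refine Finset.sum_le_sum fun i _ => Finset.sum_le_sum fun j _ => ?_
    have := mul_le_mul_of_nonneg_left (hC i j) (mul_nonneg (hs i) (ht j))
    have := mul_le_mul_of_nonneg_left (hv i j) (hW i j)
    nlinarith
  simp only [Finset.sum_add_distrib] at h3
  rw [Finset.sum_comm (f := fun i j => W i j * (t j ^ 2 + p j))] at h3
  simp only [_root_.sub_mul, one_mul, Finset.sum_mul, Finset.sum_sub_distrib,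
    Finset.sum_add_distrib] at h1 h2
  simp only [← Finset.mul_sum] at h3
  rw [Finset.mul_sum]
  simp only [← Finset.mul_sum] at h1 h2 ⊢
  linarith

lemma frobSq_sub {m n : ℕ} (X Y : Matrix (Fin m) (Fin n) ℝ) :
    frobSq (Y - X) = frobSq Y + frobSq X - 2 * (X * Yᵀ).trace := by
  simp only [frobSq, trace, diag, mul_apply, Finset.mul_sum, ← Finset.sum_add_distrib,
    ← Finset.sum_sub_distrib, Matrix.sub_apply, transpose_apply]
  exact Finset.sum_congr rfl fun i _ => Finset.sum_congr rfl fun j _ => by ring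

lemma frobSq_mul_diagonal_mul {m n : ℕ} {U : Matrix (Fin m) (Fin m) ℝ}
    {H : Matrix (Fin m) (Fin n) ℝ} (hU : Uᵀ * U = 1) (hH : H * Hᵀ = 1) (s : Fin m → ℝ) :
    frobSq (U * diagonal s * H) = ∑ i, s i ^ 2 := by
  rw [frobSq_eq_trace, transpose_mul, Matrix.mul_assoc _ H, ← Matrix.mul_assoc H, hH, Matrix.one_mul, transpose_mul,
    Matrix.mul_assoc, trace_mul_comm, Matrix.mul_assoc, Matrix.mul_assoc, hU, Matrix.mul_one, diagonal_transpose,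
    diagonal_mul_diagonal, trace_diagonal]
  simp [sq]

/-- Bounds between singular values lift to a bound on spectrally penalized least squares. -/
lemma sum_le_frobSq_sub_add {m n : ℕ} {U : Matrix (Fin m) (Fin m) ℝ}
    {H : Matrix (Fin m) (Fin n) ℝ} (hU : Uᵀ * U = 1) (hH : H * Hᵀ = 1)
    {s v : Fin m → ℝ} {ρ : ℝ → ℝ} (hs : ∀ i, 0 ≤ s i) (hρ : ∀ y, 0 ≤ y → 0 ≤ ρ y)
    (hρ0 : ρ 0 = 0) (hv : ∀ i y, 0 ≤ y → v i ≤ (y - s i) ^ 2 + ρ y)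
    (Y : Matrix (Fin m) (Fin n) ℝ) :
    ∑ i, v i ≤ frobSq (Y - U * diagonal s * H) + ∑ i, ρ (sval Y i) := by
  obtain ⟨Q, t, e, G, hQ, -, ht, he, hG, hY, hfY, hsum⟩ := exists_thin_svd Y
  set A := Uᵀ * Q with hA
  set B := H * Gᵀ with hB
  have hAA : A * Aᵀ = 1 := by
    rw [hA, transpose_mul, transpose_transpose, Matrix.mul_assoc, ← Matrix.mul_assoc Q, hQ, Matrix.one_mul, hU]
  have hAA' : Aᵀ * Aᵀᵀ = 1 := by
    rw [transpose_transpose]; exact mul_eq_one_comm.1 hAA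
  have htr : (U * diagonal s * H * Yᵀ).trace = ∑ i, ∑ j, s i * t j * (A i j * B i j) := by
    have h1 : (U * diagonal s * H * Yᵀ).trace = (diagonal s * B * diagonal t * Aᵀ).trace := by
      rw [hY, hA, hB]
      simp only [transpose_mul, transpose_transpose, diagonal_transpose]
      rw [Matrix.mul_assoc U, Matrix.mul_assoc U, trace_mul_comm U]
      simp only [Matrix.mul_assoc]
    rw [h1, trace]
    refine Finset.sum_congr rfl fun i _ => ?_
    rw [diag_apply, mul_apply]
    refine Finset.sum_congr rfl fun j _ => ?_
    rw [mul_diagonal, diagonal_mul, transpose_apply]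
    ring
  rw [frobSq_sub, hfY, frobSq_mul_diagonal_mul hU hH, htr, hsum]
  have hBrow : ∀ i, ∑ j, B i j ^ 2 ≤ 1 := fun i => by
    have := sum_sq_mul_transpose_le H G e (fun j => (he j).2) hG i
    rwa [hH, one_apply_eq] at this
  have hBcol : ∀ j, ∑ i, B i j ^ 2 ≤ 1 := fun j => by
    have := sum_sq_mul_transpose_le G H (fun _ => 1) (fun _ => le_rfl)
      (by rw [hH, diagonal_one]) j
    rw [hG, diagonal_apply_eq] at this
    have hBt : G * Hᵀ = Bᵀ := by rw [hB, transpose_mul, transpose_transpose]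
    rw [hBt] at this
    exact this.trans (he j).2
  refine sum_le_of_substochastic (W := fun i j => (A i j ^ 2 + B i j ^ 2) / 2) hs ht
    (fun j => hρ _ (ht j)) (fun i j => hv i _ (ht j)) (fun i => ?_) (fun i j => by positivity)
    (fun i => ?_) (fun j => ?_) (fun i j => ?_)
  · simpa [hρ0] using hv i 0 le_rfl
  · rw [← Finset.sum_div, Finset.sum_add_distrib, sum_sq_row_of_mul_transpose hAA]
    linarith [hBrow i]
  · have := sum_sq_row_of_mul_transpose hAA' j
    simp only [transpose_apply] at this
    rw [← Finset.sum_div, Finset.sum_add_distrib, this]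
    linarith [hBcol j]
  · linarith [sq_nonneg (A i j - B i j)]

/-- Theorem 3: given an SVD `X = U·Diag(σ(X))·Vᵀ`, the matrix
`Y* = U·Diag(g_{λμ}(σ_i(X)) or 0)·Vᵀ` obtained by singular value thresholding
(`σ_i(Y*) = g_{λμ}(σ_i(X))` when `σ_i(X) > t*` and `σ_i(Y*) = 0` when `σ_i(X) ≤ t*`)
is a global minimizer of `Y ↦ ‖Y − X‖_F² + λμ·P(Y)`. -/
theorem svt_operator_minimizes {m n : ℕ} (hmn : m ≤ n)
    (a lam μ : ℝ) (ha : 0 < a) (hlam : 0 < lam) (hμ : 0 < μ)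
    (X : Matrix (Fin m) (Fin n) ℝ)
    (U : Matrix (Fin m) (Fin m) ℝ) (V : Matrix (Fin n) (Fin n) ℝ)
    (hU : U * Uᵀ = 1 ∧ Uᵀ * U = 1) (hV : V * Vᵀ = 1 ∧ Vᵀ * V = 1)
    (hX : X = U * rdiag (sval X) * Vᵀ)
    (tstar : ℝ)
    (htstar : tstar =
      if lam ≤ 1 / (a ^ 2 * μ) then lam * μ / 2 * a else Real.sqrt (lam * μ) - 1 / (2 * a))
    (Ystar : Matrix (Fin m) (Fin n) ℝ)
    (hYstar : Ystar =
      U * rdiag (fun i => if sval X i > tstar then gFn a (lam * μ) (sval X i) else 0) * Vᵀ) :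
    ∀ Y : Matrix (Fin m) (Fin n) ℝ,
      frobSq (Ystar - X) + lam * μ * Pmat a Ystar ≤ frobSq (Y - X) + lam * μ * Pmat a Y := by
  intro Y
  have hL : 0 < lam * μ := mul_pos hlam hμ
  have ht : tstar = if lam * μ * a ^ 2 ≤ 1 then lam * μ / 2 * a
      else Real.sqrt (lam * μ) - 1 / (2 * a) := by
    rw [htstar]
    congr 1
    rw [le_div_iff₀ (by positivity), eq_iff_iff]
    ring_nf
  set h : Fin m → ℝ := fun i => if sval X i > tstar then gFn a (lam * μ) (sval X i) else 0
  set H : Matrix (Fin m) (Fin n) ℝ :=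
    (rdiag fun _ => 1 : Matrix (Fin m) (Fin n) ℝ) * Vᵀ with hHdef
  have hHH : H * Hᵀ = 1 := by
    rw [hHdef, transpose_mul, transpose_transpose, Matrix.mul_assoc, ← Matrix.mul_assoc Vᵀ, hV.2, Matrix.one_mul,
      rdiag_one_mul_transpose hmn]
  have hsplit : ∀ s : Fin m → ℝ,
      U * (rdiag s : Matrix (Fin m) (Fin n) ℝ) * Vᵀ = U * diagonal s * H := fun s => by
    rw [rdiag_eq s, hHdef]
    simp only [Matrix.mul_assoc]
  replace hX : X = U * diagonal (sval X) * H := hX.trans (hsplit _)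
  replace hYstar : Ystar = U * diagonal h * H := hYstar.trans (hsplit _)
  have hfrob : frobSq (Ystar - X) = ∑ i, (h i - sval X i) ^ 2 := by
    have : Ystar - X = U * diagonal (fun i => h i - sval X i) * H := by
      rw [hYstar]
      conv_lhs => rw [hX]
      rw [← Matrix.sub_mul, ← Matrix.mul_sub, diagonal_sub]
    rw [this, frobSq_mul_diagonal_mul hU.2 hHH]
  have hP : Pmat a Ystar = ∑ i, fracFn a (h i) := by
    rw [Pmat, sum_sval_of_mul_transpose_eq Ystar U hU.2 (fun i => h i * h i) ?_ (fracFn a)]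
    · simp [Real.sqrt_mul_self_eq_abs, fracFn]
    · rw [hYstar, transpose_mul, Matrix.mul_assoc _ H, ← Matrix.mul_assoc H, hHH, Matrix.one_mul, transpose_mul,
        diagonal_transpose, ← Matrix.mul_assoc, Matrix.mul_assoc U, diagonal_mul_diagonal]
  have key := sum_le_frobSq_sub_add (v := fun i => (h i - sval X i) ^ 2 + lam * μ * fracFn a (h i))
    (ρ := fun y => lam * μ * fracFn a y) hU.2 hHH (sval_nonneg X)
    (fun y _ => by unfold fracFn; positivity) (by simp [fracFn])
    (fun i y hy => threshold_minimizes ha hL (sval_nonneg X i) hy ht) Y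
  rw [← hX, Finset.sum_add_distrib, ← Finset.mul_sum, ← Finset.mul_sum] at key
  rw [hfrob, hP]
  exact key
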